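/- Reduction of multitangents into monotangents: let r ≥ 1 and let (s_1,…,s_r) be positive integers with s_1 ≥ 2 and s_r ≥ 2. Then for every z ∈ ℂ ∖ ℤ, Te^{s_1,…,s_r}(z) = ∑_{i=1}^{r} ∑_{σ=2}^{s_i} Teze^{s_1,…,s_r}_{i,σ} · Te^{σ}(z), where Teze^{s_1,…,s_r}_{i,σ} := ∑ Ze^{σ_1,…,σ_{i−1}} · (−1)^{s_i−σ} · (−1)^{σ_{i+1}+⋯+σ_r} · Ze^{σ_r,σ_{r−1},…,σ_{i+1}} · ∏_{j≠i} (σ_j−1)! / ((σ_j−s_j)! · (s_j−1)!), the sum running over all tuples (σ_1,…,σ_r) of positive integers with σ_i = σ, σ_j ≥ s_j for all j ≠ i, and σ_1+⋯+σ_r = s_1+⋯+s_r. (In particular no monotangent Te^{1} occurs: the reduction begins at σ = 2.) -/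

import Mathlib

open scoped Classical

/-- Multitangent function: `Te^{s₁,…,s_r}(z) = ∑_{n₁ > n₂ > ⋯ > n_r, nᵢ ∈ ℤ} ∏ (nᵢ + z)^{-sᵢ}`. -/
noncomputable def TeF {r : ℕ} (s : Fin r → ℕ) (z : ℂ) : ℂ :=
  ∑' n : {n : Fin r → ℤ // StrictAnti n},
    ∏ i : Fin r, ((n.1 i : ℂ) + z) ^ (-(s i : ℤ))

/-- Multizeta value: `Ze^{s₁,…,s_r} = ∑_{n₁ > n₂ > ⋯ > n_r > 0} ∏ nᵢ^{-sᵢ}`; `Ze^{∅} = 1`. -/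
noncomputable def Ze (t : List ℕ) : ℝ :=
  ∑' n : {n : Fin t.length → ℕ // StrictAnti n ∧ ∀ i, 0 < n i},
    ∏ i : Fin t.length, ((n.1 i : ℝ)) ^ (-(t.get i : ℤ))

/-- The coefficient `Teze^{s₁,…,s_r}_{i,σ₀}` of the monotangent `Te^{σ₀}` in the reduction of
`Te^{s₁,…,s_r}`: the sum over all tuples `(σ₁,…,σ_r)` of positive integers with `σᵢ = σ₀`,
`σⱼ ≥ sⱼ` for `j ≠ i` and `σ₁+⋯+σ_r = s₁+⋯+s_r` of
`Ze^{σ₁,…,σ_{i−1}} · (−1)^{sᵢ−σ₀} · (−1)^{σ_{i+1}+⋯+σ_r} · Ze^{σ_r,…,σ_{i+1}}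
  · ∏_{j≠i} (σⱼ−1)!/((σⱼ−sⱼ)!·(sⱼ−1)!)`. -/
noncomputable def Teze {r : ℕ} (s : Fin r → ℕ) (i : Fin r) (σ₀ : ℕ) : ℝ :=
  ∑ σ ∈ (Fintype.piFinset fun _ : Fin r => Finset.range (∑ j, s j + 1)).filter
      (fun σ => σ i = σ₀ ∧ (∀ j, j ≠ i → s j ≤ σ j) ∧ ∑ j, σ j = ∑ j, s j),
    Ze ((List.ofFn σ).take i.1) * (-1 : ℝ) ^ (s i - σ₀) *
      (-1 : ℝ) ^ (∑ j ∈ Finset.univ.filter (fun j => i < j), σ j) *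
      Ze (((List.ofFn σ).drop (i.1 + 1)).reverse) *
      ∏ j ∈ Finset.univ.filter (fun j => j ≠ i),
        ((σ j - 1).factorial : ℝ) / (((σ j - s j).factorial : ℝ) * ((s j - 1).factorial : ℝ))


lemma aux_summable_pi {β : Type*} (f : β → ℝ) (hf : Summable f) (h0 : ∀ b, 0 ≤ f b) (r : ℕ) :
    Summable (fun n : Fin r → β => ∏ i, f (n i)) := by
  induction r with
  | zero => exact (hasSum_fintype _).summable
  | succ r ih =>
    have h := hf.mul_of_nonneg ih h0 (fun n => Finset.prod_nonneg fun i _ => h0 _)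
    rw [← (Fin.consEquiv (fun _ : Fin (r+1) => β)).summable_iff]
    refine h.congr fun x => ?_
    simp [Fin.consEquiv, Fin.prod_univ_succ]

lemma aux_bound {r : ℕ} (w : Fin r → ℝ) (hw : ∀ i, 1 ≤ w i) (s : Fin r → ℕ) (hs : ∀ i, 1 ≤ s i)
    (k : Fin r) (hk : 2 ≤ s k) (hmax : ∀ i, w i ≤ w k) :
    ∏ i, (w i) ^ (-(s i : ℤ)) ≤ ∏ i, ((w i) ^ (1 + 1 / (r : ℝ)))⁻¹ := by
  have hr : (0 : ℝ) < r := by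
    have : 0 < r := lt_of_le_of_lt (Nat.zero_le _) k.2
    exact_mod_cast this
  have hpos : ∀ i, 0 < w i := fun i => lt_of_lt_of_le one_pos (hw i)
  simp only [zpow_neg, zpow_natCast]
  rw [Finset.prod_inv_distrib, Finset.prod_inv_distrib]
  apply inv_anti₀
  · exact Finset.prod_pos fun i _ => Real.rpow_pos_of_pos (hpos i) _
  have h1 : ∏ i, (w i) ^ (1 + 1 / (r : ℝ)) = (∏ i, w i) * ∏ i, (w i) ^ (1 / (r : ℝ)) := by
    rw [← Finset.prod_mul_distrib]
    refine Finset.prod_congr rfl fun i _ => ?_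
    rw [Real.rpow_add (hpos i), Real.rpow_one]
  have h2 : ∏ i, (w i) ^ (1 / (r : ℝ)) ≤ w k := by
    calc ∏ i, (w i) ^ (1 / (r : ℝ)) ≤ ∏ i : Fin r, (w k) ^ (1 / (r : ℝ)) := by
          apply Finset.prod_le_prod
          · intro i _; exact (Real.rpow_pos_of_pos (hpos i) _).le
          · intro i _; exact Real.rpow_le_rpow (hpos i).le (hmax i) (by positivity)
      _ = w k := by
          rw [Finset.prod_const, Finset.card_univ, Fintype.card_fin, ← Real.rpow_natCast,
            ← Real.rpow_mul (hpos k).le, one_div_mul_cancel hr.ne', Real.rpow_one]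
  rw [h1]
  calc (∏ i, w i) * ∏ i, (w i) ^ (1 / (r : ℝ)) ≤ (∏ i, w i) * w k := by
        apply mul_le_mul_of_nonneg_left h2
        exact Finset.prod_nonneg fun i _ => (hpos i).le
    _ = ∏ i, (w i) ^ (if i = k then 2 else 1) := by
        rw [← Finset.mul_prod_erase _ _ (Finset.mem_univ k),
          ← Finset.mul_prod_erase _ (fun i => (w i) ^ (if i = k then 2 else 1)) (Finset.mem_univ k)]
        have : ∏ i ∈ Finset.univ.erase k, w i ^ (if i = k then 2 else 1)
            = ∏ i ∈ Finset.univ.erase k, w i := by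
          refine Finset.prod_congr rfl fun i hi => ?_
          rw [if_neg (Finset.ne_of_mem_erase hi), pow_one]
        rw [this, if_pos rfl]; ring
    _ ≤ ∏ i, (w i) ^ (s i) := by
        apply Finset.prod_le_prod
        · intro i _; exact (pow_pos (hpos i) _).le
        · intro i _
          apply pow_le_pow_right₀ (hw i)
          split_ifs with h
          · rw [h]; exact hk
          · exact hs i

lemma aux_delta (z : ℂ) (hz : ∀ n : ℤ, z ≠ (n : ℂ)) :
    ∃ C : ℝ, 0 < C ∧ ∀ m : ℤ, 1 + |(m : ℝ)| ≤ C * ‖(m : ℂ) + z‖ := by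
  have ho := Complex.isOpen_compl_range_intCast
  obtain ⟨δ, hδ, hb⟩ := Metric.isOpen_iff.1 ho z (by rintro ⟨n, hn⟩; exact hz n hn.symm)
  have h1 : ∀ m : ℤ, δ ≤ ‖(m : ℂ) + z‖ := by
    intro m
    by_contra h
    push Not at h
    have : ((-m : ℤ) : ℂ) ∈ Metric.ball z δ := by
      rw [Metric.mem_ball, dist_comm, dist_eq_norm]
      push_cast
      rwa [sub_neg_eq_add, add_comm]
    exact hb this ⟨_, rfl⟩
  refine ⟨(1 + ‖z‖) / δ + 1, by positivity, fun m => ?_⟩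
  have h2 : |(m : ℝ)| ≤ ‖(m : ℂ) + z‖ + ‖z‖ := by
    have : ‖(m : ℂ)‖ ≤ ‖(m : ℂ) + z‖ + ‖z‖ := by
      calc ‖(m : ℂ)‖ = ‖((m : ℂ) + z) - z‖ := by ring_nf
        _ ≤ _ := norm_sub_le _ _
    simpa using this
  have h3 : (1 + ‖z‖) ≤ (1 + ‖z‖) / δ * ‖(m : ℂ) + z‖ := by
    rw [div_mul_eq_mul_div, le_div_iff₀ hδ]
    exact mul_le_mul_of_nonneg_left (h1 m) (by positivity)
  linarith

lemma aux_summable_int (p : ℝ) (hp : 1 < p) :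
    Summable (fun m : ℤ => ((1 + |(m : ℝ)|) ^ p)⁻¹) := by
  have h := (summable_nat_add_iff 1).2 (Real.summable_nat_rpow_inv.2 hp)
  apply Summable.of_nat_of_neg
  · refine h.congr fun n => ?_
    simp [add_comm]
  · refine h.congr fun n => ?_
    simp [add_comm]

lemma aux_te_summable {r : ℕ} (hr : 1 ≤ r) (s : Fin r → ℕ) (hpos : ∀ i, 0 < s i)
    (hr' : r - 1 < r) (hfirst : 2 ≤ s ⟨0, hr⟩) (hlast : 2 ≤ s ⟨r - 1, hr'⟩)
    (z : ℂ) (hz : ∀ n : ℤ, z ≠ (n : ℂ)) :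
    Summable (fun n : {n : Fin r → ℤ // StrictAnti n} =>
      ∏ i : Fin r, ((n.1 i : ℂ) + z) ^ (-(s i : ℤ))) := by
  obtain ⟨C, hC, hb⟩ := aux_delta z hz
  have hS := aux_summable_pi (fun m : ℤ => ((1 + |(m : ℝ)|) ^ (1 + 1 / (r : ℝ)))⁻¹)
    (aux_summable_int _ (by
      have : (0 : ℝ) < r := by exact_mod_cast hr
      have : 0 < 1 / (r : ℝ) := by positivity
      linarith)) (fun b => by positivity) r
  have hS2 := (hS.comp_injective (Subtype.val_injective (p := fun n : Fin r → ℤ => StrictAnti n))).mul_left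
    (∏ i, C ^ (s i))
  refine Summable.of_norm_bounded hS2 fun n => ?_
  rw [norm_prod]
  have h1 : ∏ i, ‖((n.1 i : ℂ) + z) ^ (-(s i : ℤ))‖
      ≤ ∏ i, (C ^ (s i) * (1 + |(n.1 i : ℝ)|) ^ (-(s i : ℤ))) := by
    apply Finset.prod_le_prod
    · intros; positivity
    · intro i _
      have hp : 0 < 1 + |(n.1 i : ℝ)| := by positivity
      rw [norm_zpow, zpow_neg, zpow_neg, zpow_natCast, zpow_natCast]
      have hq : 0 < ‖(n.1 i : ℂ) + z‖ := by
        have := hb (n.1 i)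
        by_contra h
        have h0 : ‖(n.1 i : ℂ) + z‖ = 0 := le_antisymm (not_lt.1 h) (norm_nonneg _)
        rw [h0] at this; linarith
      rw [← div_eq_mul_inv, le_div_iff₀ (by positivity), inv_mul_le_iff₀ (by positivity),
        ← mul_pow]
      apply pow_le_pow_left₀ hp.le
      rw [mul_comm]; exact hb _
  refine h1.trans ?_
  rw [Finset.prod_mul_distrib]
  apply mul_le_mul_of_nonneg_left _ (by positivity)
  set a : Fin r := ⟨0, hr⟩
  set b : Fin r := ⟨r - 1, hr'⟩
  have hle : ∀ i, n.1 i ≤ n.1 a ∧ n.1 b ≤ n.1 i := fun i =>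
    ⟨n.2.antitone (by simp [a, Fin.le_def]), n.2.antitone (by simp [b, Fin.le_def]; omega)⟩
  have hle' : ∀ i, (n.1 i : ℝ) ≤ n.1 a ∧ (n.1 b : ℝ) ≤ n.1 i := fun i =>
    ⟨by exact_mod_cast (hle i).1, by exact_mod_cast (hle i).2⟩
  have hw : ∀ i, (1 : ℝ) ≤ 1 + |(n.1 i : ℝ)| := fun i => by
    have := abs_nonneg (n.1 i : ℝ); linarith
  rcases le_total |(n.1 b : ℝ)| |(n.1 a : ℝ)| with h | h
  · refine aux_bound (fun i => 1 + |(n.1 i : ℝ)|) hw s hpos a hfirst fun i => ?_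
    have : |(n.1 i : ℝ)| ≤ max |(n.1 b : ℝ)| |(n.1 a : ℝ)| :=
      abs_le_max_abs_abs (hle' i).2 (hle' i).1
    rw [max_eq_right h] at this
    simpa using this
  · refine aux_bound (fun i => 1 + |(n.1 i : ℝ)|) hw s hpos b hlast fun i => ?_
    have : |(n.1 i : ℝ)| ≤ max |(n.1 b : ℝ)| |(n.1 a : ℝ)| :=
      abs_le_max_abs_abs (hle' i).2 (hle' i).1
    rw [max_eq_left h] at this
    simpa using this

lemma aux_ze_summable {r : ℕ} (s : Fin r → ℕ) (hpos : ∀ i, 0 < s i)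
    (hfirst : ∀ h : 0 < r, 2 ≤ s ⟨0, h⟩) :
    Summable (fun n : {n : Fin r → ℕ // StrictAnti n ∧ ∀ i, 0 < n i} =>
      ∏ i : Fin r, ((n.1 i : ℝ)) ^ (-(s i : ℤ))) := by
  rcases Nat.eq_zero_or_pos r with h0 | hr
  · subst h0; exact (hasSum_fintype _).summable
  have hS := aux_summable_pi (fun m : ℕ => ((m : ℝ) ^ (1 + 1 / (r : ℝ)))⁻¹)
    (Real.summable_nat_rpow_inv.2 (by
      have : (0 : ℝ) < r := by exact_mod_cast hr
      have : 0 < 1 / (r : ℝ) := by positivity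
      linarith)) (fun b => by positivity) r
  have hS2 := (hS.comp_injective (Subtype.val_injective
    (p := fun n : Fin r → ℕ => StrictAnti n ∧ ∀ i, 0 < n i)))
  refine Summable.of_nonneg_of_le (fun n => by positivity) (fun n => ?_) hS2
  refine aux_bound (fun i => (n.1 i : ℝ)) (fun i => by exact_mod_cast n.2.2 i) s hpos ⟨0, hr⟩
    (hfirst hr) fun i => ?_
  have : n.1 i ≤ n.1 ⟨0, hr⟩ := n.2.1.antitone (by simp [Fin.le_def])
  exact_mod_cast this

lemma aux_mono_summable (z : ℂ) (hz : ∀ n : ℤ, z ≠ (n : ℂ)) (σ : ℕ) (hσ : 2 ≤ σ) :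
    Summable (fun m : ℤ => ((m : ℂ) + z) ^ (-(σ : ℤ))) := by
  have h := aux_te_summable le_rfl (fun _ : Fin 1 => σ) (fun _ => by omega) Nat.zero_lt_one hσ hσ z hz
  have hinj : Function.Injective (fun m : ℤ =>
      (⟨fun _ => m, Subsingleton.strictAnti _⟩ : {n : Fin 1 → ℤ // StrictAnti n})) := by
    intro a b hab
    exact congrFun (congrArg Subtype.val hab) 0
  refine (h.comp_injective hinj).congr fun m => ?_
  simp

noncomputable def auxH (a : ℂ) (s : ℕ) : PowerSeries ℂ :=
  PowerSeries.mk fun n => (-1) ^ n * (Nat.choose (s - 1 + n) (s - 1) : ℂ) * (a ^ (s + n))⁻¹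

lemma auxH_mul (a : ℂ) (ha : a ≠ 0) (s : ℕ) (hs : 0 < s) :
    auxH a s * (PowerSeries.X + PowerSeries.C a) ^ s = 1 := by
  obtain ⟨d, rfl⟩ : ∃ d, s = d + 1 := ⟨s - 1, by omega⟩
  have h := PowerSeries.mk_add_choose_mul_one_sub_pow_eq_one ℂ d
  have h2 := congrArg (PowerSeries.rescale (-a⁻¹)) h
  rw [map_mul, map_pow, map_sub, map_one, PowerSeries.rescale_X, PowerSeries.rescale_mk] at h2
  have e1 : auxH a (d + 1) = PowerSeries.C ((a ^ (d+1))⁻¹) *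
      PowerSeries.mk (fun n => (-a⁻¹) ^ n * (Nat.choose (d + n) d : ℂ)) := by
    ext n
    rw [PowerSeries.coeff_C_mul, auxH, PowerSeries.coeff_mk, PowerSeries.coeff_mk,
      Nat.add_sub_cancel, neg_pow a⁻¹, pow_add a (d+1) n, mul_inv, inv_pow]
    ring
  have e2 : (PowerSeries.X + PowerSeries.C a : PowerSeries ℂ) =
      PowerSeries.C a * (1 - PowerSeries.C (-a⁻¹) * PowerSeries.X) := by
    rw [mul_sub, ← mul_assoc, ← map_mul]
    simp [ha, add_comm]
  rw [e1, e2, mul_pow, ← map_pow]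
  calc _ = (PowerSeries.C ((a ^ (d+1))⁻¹) * PowerSeries.C (a ^ (d + 1))) * 
      (PowerSeries.mk (fun n => (-a⁻¹) ^ n * (Nat.choose (d + n) d : ℂ)) * 
        (1 - PowerSeries.C (-a⁻¹) * PowerSeries.X) ^ (d+1)) := by ring
    _ = 1 := by
      rw [← map_mul, inv_mul_cancel₀ (pow_ne_zero _ ha), map_one, one_mul]
      exact h2

noncomputable def auxG {r : ℕ} (s : Fin r → ℕ) (d : Fin r → ℂ) (i : Fin r) : PowerSeries ℂ :=
  ∏ j ∈ Finset.univ.erase i, auxH (d j - d i) (s j)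

open Polynomial in
lemma aux_pf_poly {r : ℕ} (hr : 1 ≤ r) (s : Fin r → ℕ) (hpos : ∀ i, 0 < s i) (d : Fin r → ℂ)
    (hd : Function.Injective d) :
    ∑ i, ((auxG s d i).trunc (s i)).comp (X + C (d i)) *
      ∏ j ∈ Finset.univ.erase i, (X + C (d j)) ^ (s j) = (1 : ℂ[X]) := by
  set Q : ℂ[X] := ∑ i, ((auxG s d i).trunc (s i)).comp (X + C (d i)) *
      ∏ j ∈ Finset.univ.erase i, (X + C (d j)) ^ (s j) with hQ
  have hdvd : ∀ i, (X + C (d i)) ^ (s i) ∣ Q - 1 := by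
    intro i
    rw [hQ, ← Finset.add_sum_erase _ _ (Finset.mem_univ i), add_sub_right_comm]
    apply dvd_add
    rotate_left
    · apply Finset.dvd_sum
      intro j hj
      apply Dvd.dvd.mul_left
      apply Finset.dvd_prod_of_mem (fun j => (X + C (d j)) ^ (s j))
      simp only [Finset.mem_erase, Finset.mem_univ, and_true] at hj ⊢
      exact hj.symm
    · have key : (X : ℂ[X]) ^ (s i) ∣ (auxG s d i).trunc (s i) *
          ∏ j ∈ Finset.univ.erase i, (X + C (d j - d i)) ^ (s j) - 1 := by
        rw [Polynomial.X_pow_dvd_iff]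
        have hp : (PowerSeries.X : PowerSeries ℂ) ^ (s i) ∣
            (((auxG s d i).trunc (s i) *
              ∏ j ∈ Finset.univ.erase i, (X + C (d j - d i)) ^ (s j) - 1 : ℂ[X]) : PowerSeries ℂ) := by
          have e1 : auxG s d i * ((∏ j ∈ Finset.univ.erase i, (X + C (d j - d i)) ^ (s j) : ℂ[X]) : PowerSeries ℂ) = 1 := by
            have : ((∏ j ∈ Finset.univ.erase i, (X + C (d j - d i)) ^ (s j) : ℂ[X]) : PowerSeries ℂ)
                = ∏ j ∈ Finset.univ.erase i, (PowerSeries.X + PowerSeries.C (d j - d i)) ^ (s j) := by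
              rw [← Polynomial.coeToPowerSeries.ringHom_apply, map_prod]
              simp
            rw [this, auxG, ← Finset.prod_mul_distrib]
            apply Finset.prod_eq_one
            intro j hj
            apply auxH_mul _ _ _ (hpos j)
            rw [sub_ne_zero]
            exact fun h => Finset.ne_of_mem_erase hj (hd h)
          have e2 : (PowerSeries.X : PowerSeries ℂ) ^ (s i) ∣
            (((auxG s d i).trunc (s i) : ℂ[X]) : PowerSeries ℂ) - auxG s d i := by
            rw [PowerSeries.X_pow_dvd_iff]
            intro m hm
            rw [map_sub, Polynomial.coeff_coe, PowerSeries.coeff_trunc, if_pos hm, sub_self]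
          rw [Polynomial.coe_sub, Polynomial.coe_mul, Polynomial.coe_one]
          have e3 := Dvd.dvd.mul_right e2 ((∏ j ∈ Finset.univ.erase i, (X + C (d j - d i)) ^ (s j) : ℂ[X]) : PowerSeries ℂ)
          rwa [sub_mul, e1] at e3
        rw [PowerSeries.X_pow_dvd_iff] at hp
        intro m hm
        rw [← Polynomial.coeff_coe]; exact hp m hm
      obtain ⟨g, hg⟩ := key
      refine ⟨g.comp (X + C (d i)), ?_⟩
      have := congrArg (fun p => Polynomial.comp p (X + C (d i))) hg
      simp only [Polynomial.sub_comp, Polynomial.mul_comp, Polynomial.prod_comp, Polynomial.pow_comp,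
        Polynomial.add_comp, Polynomial.X_comp, Polynomial.C_comp, Polynomial.one_comp] at this
      rw [← this]
      congr 2
      refine Finset.prod_congr rfl fun j _ => ?_
      rw [add_assoc, ← C_add]; congr 3; ring
  have hP : ∏ i, (X + C (d i)) ^ (s i) ∣ Q - 1 := by
    apply Fintype.prod_dvd_of_coprime _ hdvd
    intro i j hij
    apply IsCoprime.pow
    have := Polynomial.pairwise_coprime_X_sub_C (s := fun i => - d i) (fun a b h => hd (neg_injective h)) hij
    simpa [Function.onFun] using this
  have hdeg : (Q - 1).degree < (∏ i, (X + C (d i)) ^ (s i) : ℂ[X]).degree := by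
    have hPd : (∏ i, (X + C (d i)) ^ (s i) : ℂ[X]).degree = ((∑ i, s i : ℕ) : WithBot ℕ) := by
      rw [Polynomial.degree_prod]; simp
    rw [hPd]
    have hpos' : 0 < ∑ i, s i := Finset.sum_pos (fun i _ => hpos i) ⟨⟨0, hr⟩, Finset.mem_univ _⟩
    apply lt_of_le_of_lt (Polynomial.degree_sub_le _ _)
    apply max_lt
    · refine lt_of_le_of_lt (Polynomial.degree_sum_le _ _) ?_
      rw [Finset.sup_lt_iff (by exact WithBot.bot_lt_coe _)]
      intro i _
      rw [← Polynomial.mem_degreeLT]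
      have h1 : (((auxG s d i).trunc (s i)).comp (X + C (d i))).degree < (s i : WithBot ℕ) := by
        refine lt_of_le_of_lt Polynomial.degree_le_natDegree ?_
        rw [Polynomial.natDegree_comp]
        simp only [natDegree_X_add_C, mul_one]
        have := hpos i
        obtain ⟨k, hk⟩ : ∃ k, s i = k + 1 := ⟨s i - 1, by omega⟩
        rw [hk]
        exact_mod_cast PowerSeries.natDegree_trunc_lt _ k
      have h2 : (∏ j ∈ Finset.univ.erase i, (X + C (d j)) ^ (s j) : ℂ[X]).degree 
          = ((∑ j ∈ Finset.univ.erase i, s j : ℕ) : WithBot ℕ) := by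
        rw [Polynomial.degree_prod]; simp
      rw [Polynomial.mem_degreeLT, Polynomial.degree_mul, h2,
        ← Finset.add_sum_erase _ _ (Finset.mem_univ i)]
      rw [Nat.cast_add]
      exact WithBot.add_lt_add_right (WithBot.coe_ne_bot) h1
    · rw [Polynomial.degree_one]; exact_mod_cast hpos'
  have := Polynomial.eq_zero_of_dvd_of_degree_lt hP hdeg
  exact sub_eq_zero.1 this

lemma aux_pf {r : ℕ} (hr : 1 ≤ r) (s : Fin r → ℕ) (hpos : ∀ i, 0 < s i) (d : Fin r → ℂ)
    (hd : Function.Injective d) (x : ℂ) (hx : ∀ i, x + d i ≠ 0) :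
    ∏ i, (x + d i) ^ (-(s i : ℤ)) = ∑ i, ∑ σ ∈ Finset.Icc 1 (s i),
      (PowerSeries.coeff (s i - σ) (auxG s d i)) * (x + d i) ^ (-(σ : ℤ)) := by
  have h := congrArg (Polynomial.eval x) (aux_pf_poly hr s hpos d hd)
  simp only [Polynomial.eval_finsetSum, Polynomial.eval_mul, Polynomial.eval_comp,
    Polynomial.eval_prod, Polynomial.eval_pow, Polynomial.eval_add, Polynomial.eval_X,
    Polynomial.eval_C, Polynomial.eval_one] at h
  have hP : ∀ i, (∏ j ∈ Finset.univ.erase i, (x + d j) ^ (s j)) * ∏ j, (x + d j) ^ (-(s j : ℤ))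
      = (x + d i) ^ (-(s i : ℤ)) := by
    intro i
    rw [← Finset.mul_prod_erase _ (fun j => (x + d j) ^ (-(s j : ℤ))) (Finset.mem_univ i),
      mul_left_comm, ← Finset.prod_mul_distrib]
    rw [Finset.prod_eq_one, mul_one]
    intro j _
    rw [zpow_neg, zpow_natCast, mul_inv_cancel₀ (pow_ne_zero _ (hx j))]
  calc ∏ i, (x + d i) ^ (-(s i : ℤ)) = 1 * ∏ i, (x + d i) ^ (-(s i : ℤ)) := (one_mul _).symm
    _ = ∑ i, ((auxG s d i).trunc (s i)).eval (x + d i) * (x + d i) ^ (-(s i : ℤ)) := by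
      rw [← h, Finset.sum_mul]
      refine Finset.sum_congr rfl fun i _ => ?_
      rw [mul_assoc, hP]
    _ = _ := by
      refine Finset.sum_congr rfl fun i _ => ?_
      rw [Polynomial.eval, PowerSeries.eval₂_trunc_eq_sum_range, Finset.sum_mul]
      refine Finset.sum_bij' (fun k _ => s i - k) (fun σ _ => s i - σ) ?_ ?_ ?_ ?_ ?_
      · intro k hk; simp at hk ⊢; omega
      · intro k hk; simp at hk ⊢; omega
      · intro k hk; simp at hk ⊢; omega
      · intro k hk; simp at hk ⊢; omega
      · intro k hk
        simp only [Finset.mem_range] at hk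
        have : s i - (s i - k) = k := by omega
        rw [this, mul_assoc, RingHom.id_apply]
        congr 1
        rw [← zpow_natCast, ← zpow_add₀ (hx i)]
        congr 1
        omega

lemma aux_shift (f : ℤ → ℂ) (a : ℂ) (d : ℤ) (h : HasSum f a) : HasSum (fun m => f (m + d)) a :=
  (Equiv.addRight d).hasSum_iff.2 h

lemma aux_hs_congr {β : Type*} {f g : β → ℂ} {a : ℂ} (h : HasSum f a) (e : ∀ x, f x = g x) :
    HasSum g a := (funext e : f = g) ▸ h

lemma aux_hs_nat (f : ℕ → ℂ) (a : ℂ) (hs : Summable f)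
    (h : Filter.Tendsto (fun n => ∑ k ∈ Finset.range n, f k) Filter.atTop (nhds a)) : HasSum f a :=
  hs.hasSum_iff_tendsto_nat.2 h

noncomputable def auxc {r : ℕ} (s : Fin r → ℕ) (i : Fin r) (σ₀ : ℕ) (d : Fin r → ℤ) : ℝ :=
  ∑ σ ∈ (Fintype.piFinset fun _ : Fin r => Finset.range (∑ j, s j + 1)).filter
      (fun σ => σ i = σ₀ ∧ (∀ j, j ≠ i → s j ≤ σ j) ∧ ∑ j, σ j = ∑ j, s j),
    (-1 : ℝ) ^ (s i - σ₀) *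
      (∏ j ∈ Finset.univ.filter (fun j => j ≠ i),
        ((σ j - 1).factorial : ℝ) / (((σ j - s j).factorial : ℝ) * ((s j - 1).factorial : ℝ))) *
      ∏ j ∈ Finset.univ.filter (fun j => j ≠ i), ((d j - d i : ℤ) : ℝ) ^ (-(σ j : ℤ))

lemma auxc_eq {r : ℕ} (s : Fin r → ℕ) (hpos : ∀ i, 0 < s i) (i : Fin r) (σ₀ : ℕ)
    (hσ : σ₀ ≤ s i) (d : Fin r → ℤ) :
    (auxc s i σ₀ d : ℂ) = PowerSeries.coeff (s i - σ₀) (auxG s (fun j => (d j : ℂ)) i) := by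
  have hf : Finset.univ.filter (fun j : Fin r => j ≠ i) = Finset.univ.erase i := by
    ext j; simp
  rw [auxG, PowerSeries.coeff_prod, auxc, Complex.ofReal_sum]
  symm
  refine Finset.sum_bij' (fun l _ => fun j => if j = i then σ₀ else s j + l j)
    (fun σ _ => Finsupp.equivFunOnFinite.symm (fun j => if j = i then 0 else σ j - s j)) ?_ ?_ ?_ ?_ ?_
  · intro l hl
    rw [Finset.mem_finsuppAntidiag] at hl
    have hsum : ∑ j, (if j = i then σ₀ else s j + l j) = ∑ j, s j := by
      rw [← Finset.add_sum_erase _ _ (Finset.mem_univ i),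
        ← Finset.add_sum_erase _ s (Finset.mem_univ i), if_pos rfl]
      have : ∑ j ∈ Finset.univ.erase i, (if j = i then σ₀ else s j + l j)
          = ∑ j ∈ Finset.univ.erase i, s j + (s i - σ₀) := by
        rw [← hl.1, ← Finset.sum_add_distrib]
        refine Finset.sum_congr rfl fun j hj => ?_
        rw [if_neg (Finset.ne_of_mem_erase hj)]
      rw [this]; omega
    rw [Finset.mem_filter, Fintype.mem_piFinset]
    refine ⟨fun j => ?_, by simp, fun j hj => by simp [hj], hsum⟩
    rw [Finset.mem_range, Nat.lt_succ_iff, ← hsum]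
    exact Finset.single_le_sum (f := fun j => if j = i then σ₀ else s j + l j)
      (fun _ _ => Nat.zero_le _) (Finset.mem_univ j)
  · intro σ hσ'
    rw [Finset.mem_filter] at hσ'
    obtain ⟨-, h1, h2, h3⟩ := hσ'
    rw [Finset.mem_finsuppAntidiag]
    constructor
    · rw [← Finset.add_sum_erase _ _ (Finset.mem_univ i),
        ← Finset.add_sum_erase _ s (Finset.mem_univ i), h1] at h3
      have : ∑ j ∈ Finset.univ.erase i, σ j = ∑ j ∈ Finset.univ.erase i, s j +
          ∑ j ∈ Finset.univ.erase i, (Finsupp.equivFunOnFinite.symm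
            (fun j => if j = i then 0 else σ j - s j)) j := by
        rw [← Finset.sum_add_distrib]
        refine Finset.sum_congr rfl fun j hj => ?_
        have hj' := Finset.ne_of_mem_erase hj
        have := h2 j hj'
        simp [hj']; omega
      change ∑ j ∈ Finset.univ.erase i, (Finsupp.equivFunOnFinite.symm
            (fun j => if j = i then 0 else σ j - s j)) j = _
      omega
    · intro j hj
      simp at hj ⊢
      exact hj.1
  · intro l hl
    rw [Finset.mem_finsuppAntidiag] at hl
    ext j
    by_cases hj : j = i
    · have : i ∉ l.support := fun h => by simpa using hl.2 h
      simp at this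
      simp [hj, this]
    · simp [hj]
  · intro σ hσ'
    rw [Finset.mem_filter] at hσ'
    obtain ⟨-, h1, h2, h3⟩ := hσ'
    funext j
    by_cases hj : j = i
    · simp [hj, h1]
    · have := h2 j hj
      simp [hj]; omega
  · intro l hl
    rw [Finset.mem_finsuppAntidiag] at hl
    rw [hf, ← hl.1, ← Finset.prod_pow_eq_pow_sum, mul_assoc, ← Finset.prod_mul_distrib,
      ← Finset.prod_mul_distrib, Complex.ofReal_prod]
    refine Finset.prod_congr rfl fun j hj => ?_
    have hj' := Finset.ne_of_mem_erase hj
    rw [auxH, PowerSeries.coeff_mk]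
    simp only [if_neg hj']
    have e : s j + l j - s j = l j := by omega
    have e2 : s j + l j - 1 = s j - 1 + l j := by have := hpos j; omega
    rw [e, e2, Nat.cast_choose ℂ (Nat.le_add_right _ _), Nat.add_sub_cancel_left, zpow_neg, zpow_natCast]
    push_cast
    ring

lemma aux_tend0 (w : ℂ) : Filter.Tendsto (fun n : ℕ => ((n : ℂ) + w)⁻¹) Filter.atTop (nhds 0) := by
  refine Filter.tendsto_inv₀_cobounded.comp ?_
  rw [← tendsto_norm_atTop_iff_cobounded]
  have h : Filter.Tendsto (fun n : ℕ => (n : ℝ) + (-‖w‖)) Filter.atTop Filter.atTop :=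
    Filter.tendsto_atTop_add_const_right _ _ tendsto_natCast_atTop_atTop
  refine Filter.tendsto_atTop_mono (fun n => ?_) h
  have := norm_sub_norm_le (n : ℂ) (-w)
  simpa using this

lemma aux_tend1 (z w : ℂ) (hw : ∀ n : ℕ, (n : ℂ) + w ≠ 0) :
    Filter.Tendsto (fun n : ℕ => ((n : ℂ) + z) * ((n : ℂ) + w)⁻¹) Filter.atTop (nhds 1) := by
  have h := ((aux_tend0 w).const_mul (z - w)).const_add 1
  simp only [mul_zero, add_zero] at h
  refine h.congr fun n => ?_
  have := hw n
  field_simp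
  ring

lemma aux_tend_pow (w : ℂ) (k : ℕ) (hk : 1 ≤ k) :
    Filter.Tendsto (fun n : ℕ => ((n : ℂ) + w) ^ (-(k : ℤ))) Filter.atTop (nhds 0) := by
  have h := (aux_tend0 w).pow k
  rw [zero_pow (by omega)] at h
  refine h.congr fun n => ?_
  rw [zpow_neg, zpow_natCast, inv_pow]

lemma aux_tend2 (z w : ℂ) (hw : ∀ n : ℕ, (n : ℂ) + w ≠ 0) (k : ℕ) (hk : 2 ≤ k) :
    Filter.Tendsto (fun n : ℕ => ((n : ℂ) + z) * ((n : ℂ) + w) ^ (-(k : ℤ)))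
      Filter.atTop (nhds 0) := by
  have h := (aux_tend1 z w hw).mul (aux_tend_pow w (k - 1) (by omega))
  rw [mul_zero] at h
  refine h.congr fun n => ?_
  rw [mul_assoc, ← zpow_neg_one, ← zpow_add₀ (hw n)]
  congr 2
  omega

lemma aux_sum_c {r : ℕ} (s : Fin r → ℕ) (hpos : ∀ i, 0 < s i)
    (i₀ : Fin r) (h0 : 2 ≤ s i₀)
    (w : Fin r → ℂ) (hw : ∀ i, ∀ n : ℕ, (n : ℂ) + w i ≠ 0) (c : Fin r → ℕ → ℂ)
    (h : ∀ n : ℕ, ∏ i, ((n : ℂ) + w i) ^ (-(s i : ℤ)) = ∑ i, ∑ σ ∈ Finset.Icc 1 (s i),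
      c i σ * ((n : ℂ) + w i) ^ (-(σ : ℤ))) : ∑ i, c i 1 = 0 := by
  have hL : Filter.Tendsto (fun n : ℕ => ((n : ℂ) + 0) * ∏ i, ((n : ℂ) + w i) ^ (-(s i : ℤ)))
      Filter.atTop (nhds 0) := by
    have h1 := (aux_tend2 0 (w i₀) (hw i₀) _ h0).mul
      (tendsto_finsetProd (Finset.univ.erase i₀) (fun i _ => aux_tend_pow (w i) (s i) (hpos i)))
    rw [zero_mul] at h1
    refine h1.congr fun n => ?_
    rw [mul_assoc, Finset.mul_prod_erase _ (fun i => ((n : ℂ) + w i) ^ (-(s i : ℤ))) (Finset.mem_univ _)]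
  have hR : Filter.Tendsto (fun n : ℕ => ((n : ℂ) + 0) * ∏ i, ((n : ℂ) + w i) ^ (-(s i : ℤ)))
      Filter.atTop (nhds (∑ i, ∑ σ ∈ Finset.Icc 1 (s i), c i σ * (if σ = 1 then 1 else 0))) := by
    have h1 : Filter.Tendsto (fun n : ℕ => ∑ i, ∑ σ ∈ Finset.Icc 1 (s i),
        c i σ * (((n : ℂ) + 0) * ((n : ℂ) + w i) ^ (-(σ : ℤ))))
      Filter.atTop (nhds (∑ i, ∑ σ ∈ Finset.Icc 1 (s i), c i σ * (if σ = 1 then 1 else 0))) := by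
      refine tendsto_finsetSum _ fun i _ => tendsto_finsetSum _ fun σ hσ => ?_
      refine Filter.Tendsto.const_mul _ ?_
      rw [Finset.mem_Icc] at hσ
      split_ifs with h
      · subst h
        simpa using aux_tend1 0 (w i) (hw i)
      · exact aux_tend2 0 (w i) (hw i) σ (by omega)
    refine h1.congr fun n => ?_
    rw [h, Finset.mul_sum]
    refine Finset.sum_congr rfl fun i _ => ?_
    rw [Finset.mul_sum]
    refine Finset.sum_congr rfl fun σ _ => ?_
    ring
  have := tendsto_nhds_unique hR hL
  rw [← this]
  refine Finset.sum_congr rfl fun i _ => ?_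
  rw [Finset.sum_eq_single 1]
  · simp
  · intro b _ hb; simp [hb]
  · intro hb; exfalso; apply hb; rw [Finset.mem_Icc]; exact ⟨le_rfl, hpos i⟩

lemma aux_ne (z : ℂ) (hz : ∀ n : ℤ, z ≠ (n : ℂ)) (m : ℤ) : (m : ℂ) + z ≠ 0 := by
  intro h
  apply hz (-m)
  push_cast
  linear_combination h

lemma aux_int_sum (f : ℤ → ℂ) (a b : ℂ) (hs : Summable f)
    (h1 : Filter.Tendsto (fun n : ℕ => ∑ k ∈ Finset.range n, f k) Filter.atTop (nhds a))
    (h2 : Filter.Tendsto (fun n : ℕ => ∑ k ∈ Finset.range n, f (-((k : ℤ) + 1)))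
      Filter.atTop (nhds b)) : HasSum f (a + b) := by
  have hinj : Function.Injective (fun n : ℕ => -((n : ℤ) + 1)) := by
    intro a b hab; simp at hab; exact hab
  exact HasSum.of_nat_of_neg_add_one
    (aux_hs_nat (fun n : ℕ => f n) a (hs.comp_injective Nat.cast_injective) h1)
    (aux_hs_nat (fun n : ℕ => f (-((n : ℤ) + 1))) b (hs.comp_injective hinj) h2)

lemma aux_tele_summable (z : ℂ) (hz : ∀ n : ℤ, z ≠ (n : ℂ)) :
    Summable (fun m : ℤ => (((m + 1 : ℤ) : ℂ) + z)⁻¹ - ((m : ℂ) + z)⁻¹) := by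
  have hb := ((aux_mono_summable z hz 2 le_rfl).norm)
  have hb' : Summable (fun m : ℤ => ‖(((m + 1 : ℤ) : ℂ) + z) ^ (-((2 : ℕ) : ℤ))‖) :=
    hb.comp_injective (i := fun m : ℤ => m + 1) (add_left_injective 1)
  refine Summable.of_norm_bounded (hb.add hb') fun m => ?_
  have h1 := aux_ne z hz m
  have h2 := aux_ne z hz (m + 1)
  have e : (((m + 1 : ℤ) : ℂ) + z)⁻¹ - ((m : ℂ) + z)⁻¹ =
      -((((m + 1 : ℤ) : ℂ) + z)⁻¹ * ((m : ℂ) + z)⁻¹) := by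
    rw [inv_sub_inv h2 h1, div_eq_mul_inv, mul_inv]
    push_cast
    ring
  rw [e, norm_neg, norm_mul, zpow_neg, zpow_neg, zpow_natCast, zpow_natCast, ← inv_pow, ← inv_pow,
    norm_pow, norm_pow]
  generalize ‖(((m + 1 : ℤ) : ℂ) + z)⁻¹‖ = x
  generalize ‖((m : ℂ) + z)⁻¹‖ = y
  nlinarith [sq_nonneg (x - y), sq_nonneg x, sq_nonneg y]

lemma aux_tele1 (z : ℂ) (hz : ∀ n : ℤ, z ≠ (n : ℂ)) :
    HasSum (fun m : ℤ => (((m + 1 : ℤ) : ℂ) + z)⁻¹ - ((m : ℂ) + z)⁻¹) 0 := by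
  have hs := aux_tele_summable z hz
  have := aux_int_sum _ (0 - z⁻¹) (z⁻¹ - 0) hs ?_ ?_
  · rwa [show (0 - z⁻¹) + (z⁻¹ - 0) = (0 : ℂ) by ring] at this
  · have h := (aux_tend0 z).sub_const z⁻¹
    refine h.congr fun n => ?_
    have := Finset.sum_range_sub (fun n : ℕ => ((n : ℂ) + z)⁻¹) n
    simp only [Nat.cast_zero, zero_add] at this
    rw [← this]
    refine Finset.sum_congr rfl fun k _ => ?_
    push_cast
    rfl
  · have h := ((aux_tend0 (-z)).neg).const_sub z⁻¹
    rw [neg_zero] at h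
    refine h.congr fun n => ?_
    have := Finset.sum_range_sub' (fun n : ℕ => (-(n : ℂ) + z)⁻¹) n
    simp only [Nat.cast_zero, zero_add, neg_zero] at this
    have e : -((n : ℂ) + -z)⁻¹ = (-(n : ℂ) + z)⁻¹ := by
      rw [← inv_neg]; congr 1; ring
    rw [e, ← this]
    refine Finset.sum_congr rfl fun k _ => ?_
    simp

lemma aux_tele (z : ℂ) (hz : ∀ n : ℤ, z ≠ (n : ℂ)) (d : ℤ) :
    HasSum (fun m : ℤ => (((m + d : ℤ) : ℂ) + z)⁻¹ - ((m : ℂ) + z)⁻¹) 0 := by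
  have hstep : ∀ d : ℤ, HasSum (fun m : ℤ => (((m + d + 1 : ℤ) : ℂ) + z)⁻¹ - (((m + d : ℤ) : ℂ) + z)⁻¹) 0 := by
    intro d
    exact aux_shift (fun m : ℤ => (((m + 1 : ℤ) : ℂ) + z)⁻¹ - ((m : ℂ) + z)⁻¹) 0 d (aux_tele1 z hz)
  induction d using Int.induction_on with
  | zero => simp
  | succ i ih =>
    have := (hstep i).add ih
    simpa [add_assoc] using this
  | pred i ih =>
    have := ih.sub (hstep (-i - 1))
    rw [sub_zero] at this
    refine aux_hs_congr this fun m => ?_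
    have : m + (-(i : ℤ) - 1) + 1 = m + -i := by ring
    rw [this]
    ring

lemma aux_fiber {r : ℕ} (hr : 1 ≤ r) (s : Fin r → ℕ) (hpos : ∀ i, 0 < s i)
    (i₀ : Fin r) (h0 : 2 ≤ s i₀) (z : ℂ) (hz : ∀ n : ℤ, z ≠ (n : ℂ))
    (d : Fin r → ℤ) (hd : Function.Injective d) :
    HasSum (fun m : ℤ => ∏ i, (((m + d i : ℤ) : ℂ) + z) ^ (-(s i : ℤ)))
      (∑ i, ∑ σ ∈ Finset.Icc 2 (s i), (auxc s i σ d : ℂ) * ∑' m : ℤ, ((m : ℂ) + z) ^ (-(σ : ℤ))) := by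
  have hpf : ∀ m : ℤ, ∏ i, (((m + d i : ℤ) : ℂ) + z) ^ (-(s i : ℤ)) =
      ∑ i, ∑ σ ∈ Finset.Icc 1 (s i), (auxc s i σ d : ℂ) * (((m + d i : ℤ) : ℂ) + z) ^ (-(σ : ℤ)) := by
    intro m
    have e : ∀ i, ((m + d i : ℤ) : ℂ) + z = ((m : ℂ) + z) + (d i : ℂ) := by
      intro i; push_cast; ring
    have h := aux_pf hr s hpos (fun j => (d j : ℂ)) (fun a b hab => hd (Int.cast_injective hab))
      ((m : ℂ) + z) (fun i => by rw [← e]; exact aux_ne z hz _)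
    simp only [e]
    rw [h]
    refine Finset.sum_congr rfl fun i _ => Finset.sum_congr rfl fun σ hσ => ?_
    rw [auxc_eq s hpos i σ (Finset.mem_Icc.1 hσ).2]
  have hc : ∑ i, (auxc s i 1 d : ℂ) = 0 := by
    refine aux_sum_c s hpos i₀ h0 (fun i => (d i : ℂ) + z) (fun i n => ?_)
      (fun i σ => (auxc s i σ d : ℂ)) (fun n => ?_)
    · have := aux_ne z hz (n + d i)
      push_cast at this
      rwa [add_assoc] at this
    · have := hpf n
      push_cast at this
      simpa only [add_assoc] using this
  have hsplit : ∀ i, Finset.Icc 1 (s i) = insert 1 (Finset.Icc 2 (s i)) := by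
    intro i
    have := hpos i
    ext k; simp; omega
  have h1 : HasSum (fun m : ℤ => ∑ i, (auxc s i 1 d : ℂ) *
      ((((m + d i : ℤ) : ℂ) + z)⁻¹ - ((m : ℂ) + z)⁻¹)) (∑ i : Fin r, (auxc s i 1 d : ℂ) * 0) :=
    hasSum_sum fun i _ => (aux_tele z hz (d i)).mul_left _
  have h2 : HasSum (fun m : ℤ => ∑ i, ∑ σ ∈ Finset.Icc 2 (s i), (auxc s i σ d : ℂ) *
      (((m + d i : ℤ) : ℂ) + z) ^ (-(σ : ℤ)))
      (∑ i, ∑ σ ∈ Finset.Icc 2 (s i), (auxc s i σ d : ℂ) * ∑' m : ℤ, ((m : ℂ) + z) ^ (-(σ : ℤ))) := by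
    refine hasSum_sum fun i _ => hasSum_sum fun σ hσ => HasSum.mul_left _ ?_
    exact aux_shift (fun m : ℤ => ((m : ℂ) + z) ^ (-(σ : ℤ))) _ (d i)
      (aux_mono_summable z hz σ (Finset.mem_Icc.1 hσ).1).hasSum
  have h3 := h1.add h2
  simp only [mul_zero, Finset.sum_const_zero, zero_add] at h3
  refine aux_hs_congr h3 fun m => ?_
  rw [hpf m]
  have : ∑ i, (auxc s i 1 d : ℂ) * ((((m + d i : ℤ) : ℂ) + z)⁻¹ - ((m : ℂ) + z)⁻¹)
      = ∑ i, (auxc s i 1 d : ℂ) * (((m + d i : ℤ) : ℂ) + z)⁻¹ := by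
    simp only [mul_sub, Finset.sum_sub_distrib, ← Finset.sum_mul, hc, zero_mul, sub_zero]
  rw [this, ← Finset.sum_add_distrib]
  refine Finset.sum_congr rfl fun i _ => ?_
  rw [hsplit i, Finset.sum_insert (by simp)]
  simp

lemma aux_hs_congr' {β : Type*} {f g : β → ℝ} {a : ℝ} (h : HasSum f a) (e : ∀ x, f x = g x) :
    HasSum g a := (funext e : f = g) ▸ h

lemma aux_hs_val {β : Type*} {f : β → ℝ} {a b : ℝ} (h : HasSum f a) (e : a = b) :
    HasSum f b := e ▸ h

lemma aux_Ze_eq (t : List ℕ) (p : ℕ) (h : t.length = p) (f : Fin p → ℕ)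
    (hf : ∀ j : Fin p, t.getD j 0 = f j) :
    Ze t = ∑' n : {n : Fin p → ℕ // StrictAnti n ∧ ∀ i, 0 < n i},
      ∏ j : Fin p, ((n.1 j : ℝ)) ^ (-(f j : ℤ)) := by
  subst h
  have : f = t.get := by
    funext j
    rw [← hf j]
    simp
  subst this
  rfl

lemma aux_prod_lt {r : ℕ} (i : Fin r) (f : Fin r → ℝ) :
    ∏ j ∈ Finset.univ.filter (fun j => j < i), f j
      = ∏ k : Fin i.1, f ⟨k.1, k.2.trans i.2⟩ := by
  symm
  refine Finset.prod_bij (fun k _ => ⟨k.1, k.2.trans i.2⟩) ?_ ?_ ?_ ?_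
  · intro k _; rw [Finset.mem_filter]; exact ⟨Finset.mem_univ _, k.2⟩
  · intro a _ b _ hab; simpa [Fin.ext_iff] using hab
  · intro j hj
    have hj : j.1 < i.1 := (Finset.mem_filter.1 hj).2
    exact ⟨⟨j.1, hj⟩, Finset.mem_univ _, rfl⟩
  · intro k _; rfl

lemma aux_prod_gt {r : ℕ} (i : Fin r) (f : Fin r → ℝ) :
    ∏ j ∈ Finset.univ.filter (fun j => i < j), f j
      = ∏ k : Fin (r - 1 - i.1), f ⟨r - 1 - k.1, by omega⟩ := by
  symm
  refine Finset.prod_bij (fun k _ => ⟨r - 1 - k.1, by omega⟩) ?_ ?_ ?_ ?_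
  · intro k _; rw [Finset.mem_filter]; refine ⟨Finset.mem_univ _, ?_⟩; rw [Fin.lt_def]; simp only; omega
  · intro a _ b _ hab
    simp [Fin.ext_iff] at hab ⊢
    omega
  · intro j hj
    have hj : i.1 < j.1 := (Finset.mem_filter.1 hj).2
    exact ⟨⟨r - 1 - j.1, by omega⟩, Finset.mem_univ _, by simp [Fin.ext_iff]; omega⟩
  · intro k _; rfl

noncomputable def auxInv {r : ℕ} (i : Fin r) (a : Fin i.1 → ℕ) (b : Fin (r - 1 - i.1) → ℕ)
    (k : Fin r) : ℤ :=
  if h : k.1 < i.1 then (a ⟨k.1, h⟩ : ℤ)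
  else if h2 : i.1 < k.1 then -(b ⟨r - 1 - k.1, by omega⟩ : ℤ) else 0

lemma auxInv_anti {r : ℕ} (i : Fin r) (a : Fin i.1 → ℕ) (b : Fin (r - 1 - i.1) → ℕ)
    (ha : StrictAnti a ∧ ∀ j, 0 < a j) (hb : StrictAnti b ∧ ∀ j, 0 < b j) :
    StrictAnti (auxInv i a b) := by
  intro k l hkl
  have hkl' : k.1 < l.1 := hkl
  have hlr := l.2
  have hnn : ∀ x, (0 : ℤ) < a x := fun x => by exact_mod_cast ha.2 x
  have hnb : ∀ x, (0 : ℤ) < b x := fun x => by exact_mod_cast hb.2 x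
  unfold auxInv
  by_cases hl : l.1 < i.1
  · rw [dif_pos hl, dif_pos (hkl'.trans hl)]
    have : (⟨k.1, hkl'.trans hl⟩ : Fin i.1) < ⟨l.1, hl⟩ := hkl'
    exact_mod_cast ha.1 this
  rw [dif_neg hl]
  by_cases hk : k.1 < i.1
  · rw [dif_pos hk]
    by_cases hl2 : i.1 < l.1
    · rw [dif_pos hl2]
      have := hnn ⟨k.1, hk⟩
      have := hnb ⟨r - 1 - l.1, by omega⟩
      linarith
    · rw [dif_neg hl2]; exact hnn _
  rw [dif_neg hk, dif_pos (show i.1 < l.1 by omega)]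
  by_cases hk2 : i.1 < k.1
  · rw [dif_pos hk2]
    have h : (⟨r - 1 - l.1, by omega⟩ : Fin (r - 1 - i.1)) < ⟨r - 1 - k.1, by omega⟩ := by
      rw [Fin.lt_def]; simp only; omega
    have h2 := hb.1 h
    have : (b ⟨r - 1 - k.1, by omega⟩ : ℤ) < b ⟨r - 1 - l.1, by omega⟩ := by exact_mod_cast h2
    linarith
  · rw [dif_neg hk2]
    have := hnb ⟨r - 1 - l.1, by omega⟩
    linarith

noncomputable def auxEquiv {r : ℕ} (hr : 0 < r) (i : Fin r) :
    {d : Fin r → ℤ // StrictAnti d ∧ d ⟨0, hr⟩ = 0} ≃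
      {n : Fin i.1 → ℕ // StrictAnti n ∧ ∀ j, 0 < n j} ×
      {n : Fin (r - 1 - i.1) → ℕ // StrictAnti n ∧ ∀ j, 0 < n j} where
  toFun d := 
    (⟨fun k => (d.1 ⟨k.1, k.2.trans i.2⟩ - d.1 i).toNat, by
      constructor
      · intro k l hkl
        have h1 := d.2.1 (show (⟨k.1, k.2.trans i.2⟩ : Fin r) < ⟨l.1, l.2.trans i.2⟩ from hkl)
        have h2 := d.2.1 (show (⟨l.1, l.2.trans i.2⟩ : Fin r) < i from l.2)
        exact (Int.toNat_lt_toNat (by omega)).2 (by omega)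
      · intro l
        have h2 := d.2.1 (show (⟨l.1, l.2.trans i.2⟩ : Fin r) < i from l.2)
        show 0 < (_ - _ : ℤ).toNat
        omega⟩,
     ⟨fun k => (d.1 i - d.1 ⟨r - 1 - k.1, by omega⟩).toNat, by
      constructor
      · intro k l hkl
        have h1 := d.2.1 (show (⟨r - 1 - l.1, by omega⟩ : Fin r) < ⟨r - 1 - k.1, by omega⟩ by
          rw [Fin.lt_def] at hkl ⊢; simp; omega)
        have h2 := d.2.1 (show i < (⟨r - 1 - l.1, by omega⟩ : Fin r) by
          rw [Fin.lt_def]; simp; omega)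
        exact (Int.toNat_lt_toNat (by omega)).2 (by omega)
      · intro l
        have h2 := d.2.1 (show i < (⟨r - 1 - l.1, by omega⟩ : Fin r) by
          rw [Fin.lt_def]; simp; omega)
        show 0 < (_ - _ : ℤ).toNat
        omega⟩)
  invFun x := ⟨fun k => auxInv i x.1.1 x.2.1 k - auxInv i x.1.1 x.2.1 ⟨0, hr⟩, by
    constructor
    · intro k l hkl
      have := auxInv_anti i _ _ x.1.2 x.2.2 hkl
      show _ - _ < _ - _
      omega
    · simp⟩
  left_inv d := by
    have key : ∀ k, auxInv i (fun k => (d.1 ⟨k.1, k.2.trans i.2⟩ - d.1 i).toNat)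
        (fun k => (d.1 i - d.1 ⟨r - 1 - k.1, by omega⟩).toNat) k = d.1 k - d.1 i := by
      intro k
      unfold auxInv
      split_ifs with h1 h2
      · have h2 := d.2.1 (show k < i from h1)
        simp; omega
      · have h3 := d.2.1 (show i < k from h2)
        have e : (⟨r - 1 - (r - 1 - k.1), by omega⟩ : Fin r) = k := by
          simp [Fin.ext_iff]; omega
        simp [e]; omega
      · have : k = i := by rw [Fin.ext_iff]; omega
        rw [this]; simp
    apply Subtype.ext
    funext k
    simp only [key]
    have := d.2.2
    omega
  right_inv x := by
    have hi : auxInv i x.1.1 x.2.1 i = 0 := by simp [auxInv]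
    apply Prod.ext
    · apply Subtype.ext
      funext k
      have : auxInv i x.1.1 x.2.1 ⟨k.1, k.2.trans i.2⟩ = x.1.1 k := by simp [auxInv]
      simp only [this, hi]
      omega
    · apply Subtype.ext
      funext k
      have : auxInv i x.1.1 x.2.1 ⟨r - 1 - k.1, by omega⟩ = -(x.2.1 k : ℤ) := by
        have h1 : ¬ (r - 1 - k.1 < i.1) := by omega
        have h2 : i.1 < r - 1 - k.1 := by omega
        have h3 : r - 1 - (r - 1 - k.1) = k.1 := by omega
        simp [auxInv, h1, h2, h3]
      simp only [this, hi]
      omega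

lemma aux_point {r : ℕ} (hr : 0 < r) (i : Fin r) (σ : Fin r → ℕ)
    (d : {d : Fin r → ℤ // StrictAnti d ∧ d ⟨0, hr⟩ = 0}) :
    ∏ j ∈ Finset.univ.filter (fun j => j ≠ i), ((d.1 j - d.1 i : ℤ) : ℝ) ^ (-(σ j : ℤ)) =
    (∏ k : Fin i.1, ((((auxEquiv hr i) d).1.1 k : ℕ) : ℝ) ^ (-(σ ⟨k.1, k.2.trans i.2⟩ : ℤ))) *
     ((-1 : ℝ) ^ (∑ j ∈ Finset.univ.filter (fun j => i < j), σ j) *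
      ∏ k : Fin (r - 1 - i.1), ((((auxEquiv hr i) d).2.1 k : ℕ) : ℝ) ^
        (-(σ ⟨r - 1 - k.1, by omega⟩ : ℤ))) := by
  have hsplit : Finset.univ.filter (fun j => j ≠ i) =
      (Finset.univ.filter (fun j => j < i)) ∪ (Finset.univ.filter (fun j => i < j)) := by
    ext j; simp
  have hdisj : Disjoint (Finset.univ.filter (fun j => j < i)) (Finset.univ.filter (fun j => i < j)) := by
    rw [Finset.disjoint_left]
    intro j; simp; exact fun h => h.le
  rw [hsplit, Finset.prod_union hdisj, ← Finset.prod_pow_eq_pow_sum, aux_prod_lt, aux_prod_gt,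
    aux_prod_gt]
  simp only [auxEquiv, Equiv.coe_fn_mk]
  rw [← Finset.prod_mul_distrib]
  congr 1
  · refine Finset.prod_congr rfl fun k _ => ?_
    congr 1
    have h2 := d.2.1 (show (⟨k.1, k.2.trans i.2⟩ : Fin r) < i from k.2)
    have : (((d.1 ⟨k.1, k.2.trans i.2⟩ - d.1 i).toNat : ℕ) : ℤ) = d.1 ⟨k.1, k.2.trans i.2⟩ - d.1 i := by
      omega
    exact_mod_cast (congrArg (fun x : ℤ => (x : ℝ)) this).symm
  · refine Finset.prod_congr rfl fun k _ => ?_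
    have h2 := d.2.1 (show i < (⟨r - 1 - k.1, by omega⟩ : Fin r) by
          rw [Fin.lt_def]; simp; omega)
    have : (((d.1 i - d.1 ⟨r - 1 - k.1, by omega⟩).toNat : ℕ) : ℤ)
        = d.1 i - d.1 ⟨r - 1 - k.1, by omega⟩ := by
      omega
    have h3 : (((d.1 i - d.1 ⟨r - 1 - k.1, by omega⟩).toNat : ℕ) : ℝ)
        = ((d.1 i - d.1 ⟨r - 1 - k.1, by omega⟩ : ℤ) : ℝ) := by
      exact_mod_cast congrArg (fun x : ℤ => (x : ℝ)) this
    rw [h3]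
    have h4 : ((d.1 ⟨r - 1 - k.1, by omega⟩ - d.1 i : ℤ) : ℝ) =
      (-1) * ((d.1 i - d.1 ⟨r - 1 - k.1, by omega⟩ : ℤ) : ℝ) := by push_cast; ring
    rw [h4, mul_zpow]
    congr 1
    rw [zpow_neg, zpow_natCast, ← inv_pow]
    norm_num

lemma aux_mul_hs {α β γ : Type*} (e : γ ≃ α × β) (f : α → ℝ) (g : β → ℝ) (c : ℝ)
    (hf : Summable f) (hg : Summable g) :
    HasSum (fun d => f (e d).1 * (c * g (e d).2)) ((∑' x, f x) * (c * ∑' x, g x)) := by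
  have hg' := hg.mul_left c
  have hm := hf.hasSum.mul (hg.hasSum.mul_left c)
    (summable_mul_of_summable_norm hf.norm hg'.norm)
  exact e.hasSum_iff.2 hm

lemma aux_shape {r : ℕ} (hr : 0 < r) (i : Fin r) (σ : Fin r → ℕ) (hpos : ∀ j, j ≠ i → 0 < σ j)
    (h0 : i ≠ ⟨0, hr⟩ → 2 ≤ σ ⟨0, hr⟩) (hr' : r - 1 < r) (h1 : i ≠ ⟨r - 1, hr'⟩ → 2 ≤ σ ⟨r - 1, hr'⟩) :
    HasSum (fun d : {d : Fin r → ℤ // StrictAnti d ∧ d ⟨0, hr⟩ = 0} =>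
      ∏ j ∈ Finset.univ.filter (fun j => j ≠ i), ((d.1 j - d.1 i : ℤ) : ℝ) ^ (-(σ j : ℤ)))
      (Ze ((List.ofFn σ).take i.1) * ((-1 : ℝ) ^ (∑ j ∈ Finset.univ.filter (fun j => i < j), σ j) *
      Ze (((List.ofFn σ).drop (i.1 + 1)).reverse))) := by
  set f : Fin i.1 → ℕ := fun k => σ ⟨k.1, k.2.trans i.2⟩ with hf
  set g : Fin (r - 1 - i.1) → ℕ := fun k => σ ⟨r - 1 - k.1, by omega⟩ with hg
  have hZ1 := aux_Ze_eq ((List.ofFn σ).take i.1) i.1 (by have := i.2; rw [List.length_take, List.length_ofFn]; omega) f (by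
    intro j
    have hj := j.2
    have hi := i.2
    rw [List.getD_eq_getElem _ _ (by rw [List.length_take, List.length_ofFn]; omega)]
    simp [hf])
  have hZ2 := aux_Ze_eq (((List.ofFn σ).drop (i.1 + 1)).reverse) (r - 1 - i.1) (by rw [List.length_reverse, List.length_drop, List.length_ofFn]; omega) g (by
    intro j
    have hj := j.2
    have hi := i.2
    rw [List.getD_eq_getElem _ _ (by rw [List.length_reverse, List.length_drop, List.length_ofFn]; omega)]
    simp [hg]
    congr 1
    rw [Fin.ext_iff]
    simp
    omega)
  have hS1 := aux_ze_summable f (fun k => hpos _ (by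
      intro h; have := k.2; have := congrArg Fin.val h; simp at this; omega)) (fun h => h0 (by
      intro h'; rw [h'] at h; simp at h))
  have hS2 := aux_ze_summable g (fun k => hpos _ (by
      intro h; have := k.2; have := congrArg Fin.val h; simp at this; omega)) (fun h => h1 (by
      intro h'; rw [h'] at h; simp at h))
  have hm := aux_mul_hs (auxEquiv hr i) _ _
    ((-1 : ℝ) ^ (∑ j ∈ Finset.univ.filter (fun j => i < j), σ j)) hS1 hS2
  rw [hZ1, hZ2]
  refine aux_hs_congr' hm fun d => ?_
  exact (aux_point hr i σ d).symm

lemma aux_c_hasSum {r : ℕ} (hr : 1 ≤ r) (s : Fin r → ℕ) (hpos : ∀ i, 0 < s i)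
    (hr' : r - 1 < r) (hfirst : 2 ≤ s ⟨0, hr⟩) (hlast : 2 ≤ s ⟨r - 1, hr'⟩) (i : Fin r) (σ₀ : ℕ) :
    HasSum (fun d : {d : Fin r → ℤ // StrictAnti d ∧ d ⟨0, hr⟩ = 0} => auxc s i σ₀ d.1)
      (Teze s i σ₀) := by
  unfold auxc Teze
  refine hasSum_sum fun σ hσ => ?_
  rw [Finset.mem_filter] at hσ
  obtain ⟨-, h1, h2, h3⟩ := hσ
  have h := aux_shape hr i σ (fun j hj => (hpos j).trans_le (h2 j hj))
    (fun hi => hfirst.trans (h2 _ hi.symm)) hr' (fun hi => hlast.trans (h2 _ hi.symm))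
  have h' := h.mul_left ((-1 : ℝ) ^ (s i - σ₀) *
      (∏ j ∈ Finset.univ.filter (fun j => j ≠ i),
        ((σ j - 1).factorial : ℝ) / (((σ j - s j).factorial : ℝ) * ((s j - 1).factorial : ℝ))))
  refine aux_hs_val h' ?_
  ring

lemma aux_mono_eq (σ : ℕ) (z : ℂ) :
    TeF (fun _ : Fin 1 => σ) z = ∑' m : ℤ, ((m : ℂ) + z) ^ (-(σ : ℤ)) := by
  unfold TeF
  let e : ℤ ≃ {n : Fin 1 → ℤ // StrictAnti n} :=
    { toFun := fun m => ⟨fun _ => m, Subsingleton.strictAnti _⟩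
      invFun := fun n => n.1 0
      left_inv := fun m => rfl
      right_inv := fun n => by
        apply Subtype.ext
        funext k
        rw [Subsingleton.elim k 0] }
  rw [← e.tsum_eq]
  refine tsum_congr fun m => ?_
  simp [e]

def auxSplit {r : ℕ} (hr : 0 < r) :
    {d : Fin r → ℤ // StrictAnti d ∧ d ⟨0, hr⟩ = 0} × ℤ ≃ {n : Fin r → ℤ // StrictAnti n} where
  toFun x := ⟨fun k => x.2 + x.1.1 k, fun a b hab => by
    have := x.1.2.1 hab
    show _ + _ < _ + _
    omega⟩
  invFun n := (⟨fun k => n.1 k - n.1 ⟨0, hr⟩, fun a b hab => by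
    have := n.2 hab
    show _ - _ < _ - _
    omega, by simp⟩, n.1 ⟨0, hr⟩)
  left_inv x := by
    have := x.1.2.2
    apply Prod.ext
    · apply Subtype.ext
      funext k
      simp [this]
    · simp [this]
  right_inv n := by
    apply Subtype.ext
    funext k
    simp

/-- Reduction of multitangents into monotangents, with multizeta coefficients; the reduction
begins at `σ₀ = 2`, i.e. no monotangent `Te^1` occurs. -/
theorem multitangent_reduction_to_monotangents
    {r : ℕ} (hr : 1 ≤ r) (s : Fin r → ℕ) (hpos : ∀ i, 0 < s i)
    (hfirst : 2 ≤ s ⟨0, by omega⟩) (hlast : 2 ≤ s ⟨r - 1, by omega⟩)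
    (z : ℂ) (hz : ∀ n : ℤ, z ≠ (n : ℂ)) :
    TeF s z = ∑ i : Fin r, ∑ σ₀ ∈ Finset.Icc 2 (s i),
      (Teze s i σ₀ : ℂ) * TeF (fun _ : Fin 1 => σ₀) z := by
  have hS := (aux_te_summable hr s hpos (Nat.sub_lt hr Nat.one_pos) hfirst hlast z hz).hasSum
  rw [← (auxSplit hr).hasSum_iff] at hS
  have hF := hS.prod_fiberwise (fun d => aux_fiber hr s hpos ⟨0, hr⟩ hfirst z hz d.1 d.2.1.injective)
  have hT : HasSum (fun d : {d : Fin r → ℤ // StrictAnti d ∧ d ⟨0, hr⟩ = 0} =>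
      ∑ i, ∑ σ ∈ Finset.Icc 2 (s i), (auxc s i σ d.1 : ℂ) * ∑' m : ℤ, ((m : ℂ) + z) ^ (-(σ : ℤ)))
      (∑ i, ∑ σ ∈ Finset.Icc 2 (s i), (Teze s i σ : ℂ) * ∑' m : ℤ, ((m : ℂ) + z) ^ (-(σ : ℤ))) := by
    refine hasSum_sum fun i _ => hasSum_sum fun σ _ => HasSum.mul_right _ ?_
    exact Complex.hasSum_ofReal.2 (aux_c_hasSum hr s hpos (Nat.sub_lt hr Nat.one_pos) hfirst hlast i σ)
  have := hF.unique hT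
  simp only [aux_mono_eq]
  exact this
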